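/- Let F be a finite almost-disjoint family of finite sets, i.e., |S ∩ T| ≤ 1 for any two distinct S, T ∈ F. Then the simplicial complex generated by F (whose faces are all subsets of members of F) is 2-collapsible. -/

import Mathlib

/-- A finite abstract simplicial complex: a finite family of finite sets
closed under taking subsets. -/
def IsComplex {V : Type*} [DecidableEq V] (K : Finset (Finset V)) : Prop :=
  ∀ σ ∈ K, ∀ τ ⊆ σ, τ ∈ K

/-- `σ` is a `d`-collapsible face of `K`: it is a face of dimension `≤ d - 1`
(i.e. with at most `d` vertices) contained in a unique inclusion-maximal face of `K`. -/
def IsCollapsibleFace {V : Type*} [DecidableEq V] (K : Finset (Finset V)) (d : ℕ)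
    (σ : Finset V) : Prop :=
  σ ∈ K ∧ σ.card ≤ d ∧
    ∃! τ, τ ∈ K ∧ σ ⊆ τ ∧ ∀ ρ ∈ K, τ ⊆ ρ → ρ = τ

/-- An elementary `d`-collapse: remove all faces `η` with `σ ⊆ η ⊆ τ`, where `σ` is a
`d`-collapsible face and `τ` is the unique maximal face containing it. -/
def ElemCollapse {V : Type*} [DecidableEq V] (d : ℕ) (K K' : Finset (Finset V)) : Prop :=
  ∃ σ τ : Finset V, σ ∈ K ∧ σ.card ≤ d ∧
    (τ ∈ K ∧ σ ⊆ τ ∧ ∀ ρ ∈ K, τ ⊆ ρ → ρ = τ) ∧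
    (∀ τ' ∈ K, σ ⊆ τ' → (∀ ρ ∈ K, τ' ⊆ ρ → ρ = τ') → τ' = τ) ∧
    K' = K.filter (fun η => ¬ (σ ⊆ η ∧ η ⊆ τ))

/-- `K` is `d`-collapsible: some sequence of elementary `d`-collapses reduces `K`
to the empty complex. -/
def Collapsible {V : Type*} [DecidableEq V] (d : ℕ) (K : Finset (Finset V)) : Prop :=
  Relation.ReflTransGen (ElemCollapse d) K ∅

/-- `K` is `d`-representable: it is (isomorphic to) the nerve of a family of convex
sets in `ℝ^d` indexed by its vertices. -/
def Representable {V : Type*} [DecidableEq V] (d : ℕ) (K : Finset (Finset V)) : Prop :=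
  ∃ C : V → Set (Fin d → ℝ), (∀ v, Convex ℝ (C v)) ∧
    ∀ σ : Finset V, σ ∈ K ↔ ∃ x, ∀ v ∈ σ, x ∈ C v

theorem elemCollapse_filter {V : Type*} [DecidableEq V] {d : ℕ} {K : Finset (Finset V)}
    {σ τ : Finset V} (hσ : σ ∈ K) (hd : σ.card ≤ d) (hτ : τ ∈ K)
    (hmax : ∀ η ∈ K, σ ⊆ η → η ⊆ τ) :
    ElemCollapse d K (K.filter fun η => ¬ σ ⊆ η) := by
  have hστ := hmax σ hσ subset_rfl
  refine ⟨σ, τ, hσ, hd, ⟨hτ, hστ, fun ρ hρ h => (hmax ρ hρ (hστ.trans h)).antisymm h⟩,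
    fun τ' hτ' h hτ'max => (hτ'max τ hτ (hmax τ' hτ' h)).symm, ?_⟩
  exact Finset.filter_congr fun η hη =>
    not_congr ⟨fun h => ⟨h, hmax η hη h⟩, And.left⟩

/-- A family all of whose members have at most `d` elements is `d`-collapsible. -/
theorem collapsible_of_card_le {V : Type*} [DecidableEq V] {d : ℕ} (K : Finset (Finset V))
    (hK : ∀ η ∈ K, η.card ≤ d) : Collapsible d K := by
  induction K using Finset.strongInduction with
  | H K ih =>
    rcases K.eq_empty_or_nonempty with rfl | hne
    · exact Relation.ReflTransGen.refl
    obtain ⟨τ, hτ⟩ := K.exists_maximal hne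
    refine Relation.ReflTransGen.head
      (elemCollapse_filter hτ.prop (hK τ hτ.prop) hτ.prop fun η hη h => hτ.le_of_ge hη h) ?_
    refine ih _ ?_ fun η hη => hK η (Finset.mem_filter.1 hη).1
    exact Finset.filter_ssubset.2 ⟨τ, hτ.prop, by simp⟩

/-- If no edge from `a` to `X` lies in `R`, while all subsets of `X` do, then the simplex on
`insert a X` attached to `R` can be 2-collapsed down to the vertex `a`. -/
theorem collapse_cone {V : Type*} [DecidableEq V] (R : Finset (Finset V)) (a : V)
    (X : Finset V) (ha : a ∉ X) (hX : X.powerset ⊆ R)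
    (hR : ∀ b ∈ X, ∀ η ∈ R, a ∈ η → b ∉ η) :
    Relation.ReflTransGen (ElemCollapse 2)
      (R ∪ (insert a X).powerset) (R ∪ ({a} : Finset V).powerset) := by
  induction X using Finset.induction_on with
  | empty => exact Relation.ReflTransGen.refl
  | insert b X hb ih =>
    rw [Finset.mem_insert, not_or] at ha
    have hab : ({a, b} : Finset V) ⊆ insert a (insert b X) := by
      intro x; simp only [Finset.mem_insert, Finset.mem_singleton]; tauto
    refine Relation.ReflTransGen.head (b := R ∪ (insert a X).powerset) ?_
      (ih ha.2 ((Finset.powerset_mono.2 (Finset.subset_insert _ _)).trans hX)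
        fun c hc => hR c (Finset.mem_insert_of_mem hc))
    have key := elemCollapse_filter (d := 2) (K := R ∪ (insert a (insert b X)).powerset)
      (σ := {a, b}) (τ := insert a (insert b X))
      (Finset.mem_union_right _ (Finset.mem_powerset.2 hab)) Finset.card_le_two
      (Finset.mem_union_right _ (Finset.mem_powerset_self _)) ?_
    · convert key using 1
      ext η
      simp only [Finset.mem_union, Finset.mem_filter, Finset.mem_powerset,
        Finset.insert_subset_iff, Finset.singleton_subset_iff]
      constructor
      · rintro (h | h)
        · exact ⟨Or.inl h, fun h' => hR b (Finset.mem_insert_self _ _) η h h'.1 h'.2⟩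
        · refine ⟨Or.inr (h.trans (Finset.insert_subset_insert _ (Finset.subset_insert _ _))),
            fun h' => ?_⟩
          have := h h'.2
          grind
      · rintro ⟨h | h, hn⟩
        · exact Or.inl h
        · by_cases haη : a ∈ η
          · right
            intro x hx
            have := h hx
            grind
          · left
            refine hX (Finset.mem_powerset.2 fun x hx => ?_)
            have := h hx
            grind
    · intro η hη h
      rcases Finset.mem_union.1 hη with h' | h'
      · exact absurd (h (by simp)) (hR b (Finset.mem_insert_self _ _) η h' (h (by simp)))
      · exact Finset.mem_powerset.1 h'

/-- For a finite almost-disjoint family `F` of finite sets (any two distinct members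
share at most one element), the simplicial complex generated by `F` (all subsets of
members of `F`) is 2-collapsible. -/
theorem almostDisjoint_collapsible {V : Type*} [DecidableEq V] (F : Finset (Finset V))
    (hF : ∀ S ∈ F, ∀ T ∈ F, S ≠ T → (S ∩ T).card ≤ 1) :
    Collapsible 2 (F.biUnion Finset.powerset) := by
  induction hK : F.biUnion Finset.powerset using Finset.strongInduction generalizing F with
  | H K ih =>
    subst hK
    by_cases hsmall : ∀ S ∈ F, S.card ≤ 1
    · refine collapsible_of_card_le _ fun η hη => ?_
      obtain ⟨S, hS, h⟩ := Finset.mem_biUnion.1 hη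
      exact (Finset.card_le_card (Finset.mem_powerset.1 h)).trans ((hsmall S hS).trans one_le_two)
    push Not at hsmall
    obtain ⟨S, hS, hcard⟩ := hsmall
    obtain ⟨a, ha⟩ := Finset.card_pos.1 (zero_lt_one.trans hcard)
    -- An edge of `S` lies in no other member of `F`.
    have hedge : ∀ T ∈ F, T ≠ S → ∀ x ∈ S, ∀ y ∈ S, x ∈ T → y ∈ T → x = y :=
      fun T hT hne x hx y hy hxT hyT => Finset.card_le_one.1 (hF T hT S hS hne) x
        (Finset.mem_inter.2 ⟨hxT, hx⟩) y (Finset.mem_inter.2 ⟨hyT, hy⟩)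
    obtain ⟨G, hG⟩ : ∃ G, G = insert (S.erase a) (F.erase S) := ⟨_, rfl⟩
    have hstep := collapse_cone (G.biUnion Finset.powerset) a (S.erase a)
      (Finset.notMem_erase a S)
      (Finset.subset_biUnion_of_mem Finset.powerset (hG ▸ Finset.mem_insert_self _ _)) (by
        intro b hb η hη haη hbη
        obtain ⟨T, hT, hηT⟩ := Finset.mem_biUnion.1 hη
        rw [Finset.mem_powerset] at hηT
        rcases Finset.mem_insert.1 (hG ▸ hT) with rfl | hT
        · exact Finset.notMem_erase a S (hηT haη)
        · exact (Finset.ne_of_mem_erase hb) (hedge T (Finset.mem_of_mem_erase hT)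
            (Finset.ne_of_mem_erase hT) b (Finset.mem_of_mem_erase hb) a ha
            (hηT hbη) (hηT haη)))
    have hstart : G.biUnion Finset.powerset ∪ (insert a (S.erase a)).powerset =
        F.biUnion Finset.powerset := by
      rw [Finset.insert_erase ha, hG, Finset.biUnion_insert]
      conv_rhs => rw [← Finset.insert_erase hS, Finset.biUnion_insert]
      have := Finset.powerset_mono.2 (Finset.erase_subset a S)
      rw [Finset.union_right_comm, Finset.union_eq_right.2 this]
    have hend : G.biUnion Finset.powerset ∪ ({a} : Finset V).powerset =
        (insert {a} G).biUnion Finset.powerset := by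
      rw [Finset.biUnion_insert, Finset.union_comm]
    rw [hstart, hend] at hstep
    refine hstep.trans (ih _ ?_ (insert {a} G) ?_ rfl)
    · rw [Finset.ssubset_iff_of_subset]
      · refine ⟨S, Finset.mem_biUnion.2 ⟨S, hS, Finset.mem_powerset_self S⟩, fun h => ?_⟩
        obtain ⟨T, hT, hST⟩ := Finset.mem_biUnion.1 h
        rw [Finset.mem_powerset] at hST
        simp only [hG, Finset.mem_insert, Finset.mem_erase] at hT
        rcases hT with rfl | rfl | ⟨hne, hT⟩
        · have := Finset.card_le_card hST
          simp at this
          omega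
        · exact Finset.notMem_erase a S (hST ha)
        · have := Finset.card_le_one.2 fun x hx y hy =>
            hedge T hT hne x hx y hy (hST hx) (hST hy)
          omega
      · rw [← hend, ← hstart]
        exact Finset.union_subset_union_right (Finset.powerset_mono.2 (by simp))
    · have hsub : ∀ T ∈ insert {a} G, T.card ≤ 1 ∨ T = S.erase a ∨ (T ≠ S ∧ T ∈ F) := by
        intro T hT
        simp only [hG, Finset.mem_insert, Finset.mem_erase] at hT
        rcases hT with rfl | h
        · simp
        · exact Or.inr h
      intro T hT U hU hne
      rcases hsub T hT with h | rfl | ⟨hTS, hTF⟩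
      · exact (Finset.card_le_card Finset.inter_subset_left).trans h
      all_goals rcases hsub U hU with h | rfl | ⟨hUS, hUF⟩
      · exact (Finset.card_le_card Finset.inter_subset_right).trans h
      · exact absurd rfl hne
      · exact (Finset.card_le_card (Finset.inter_subset_inter_right
          (Finset.erase_subset a S))).trans (hF S hS U hUF hUS.symm)
      · exact (Finset.card_le_card Finset.inter_subset_right).trans h
      · exact (Finset.card_le_card (Finset.inter_subset_inter_left
          (Finset.erase_subset a S))).trans (hF T hTF S hS hTS)
      · exact hF T hTF U hUF hne
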